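/- Let p : ℝ → ℝ^n be a polynomial curve with p_j(t) = ∑_{k=1}^{d} a_{jk} t^k for j = 1,…,n. Then the following are equivalent: (i) the dilations of p equidistribute in 𝕋^n, i.e., the measures μ_λ converge in the weak* topology to the Haar probability measure on 𝕋^n as λ → ∞; (ii) the dilations of p become dense, i.e., for every ε > 0 there exists λ > 0 such that the projection of λ p([0,1]) to 𝕋^n is ε-dense (every point of 𝕋^n is within distance ε of some point of the projected curve). -/

import Mathlib

open MeasureTheory Finset Matrix Filter

open scoped Topology FourierTransform

/-- A function whose derivative vanishes only on a null set pulls back null sets to null sets. -/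
theorem quasiMeasurePreserving_of_deriv_ne_zero {f : ℝ → ℝ} (hf : ContDiff ℝ 1 f)
    (h0 : volume {x | deriv f x = 0} = 0) :
    Measure.QuasiMeasurePreserving f volume volume := by
  refine ⟨hf.continuous.measurable, Measure.AbsolutelyContinuous.mk fun s hs hs0 => ?_⟩
  rw [Measure.map_apply hf.continuous.measurable hs]
  have hreg : volume (f ⁻¹' s ∩ {x | deriv f x ≠ 0}) = 0 := by
    refine measure_null_of_locally_null _ fun x hx => ?_
    have hstrict : HasStrictDerivAt f (deriv f x) x :=
      (hf.contDiffAt (x := x)).hasStrictDerivAt one_ne_zero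
    have hstrict' := hstrict.hasStrictFDerivAt_equiv hx.2
    set e := hstrict'.toOpenPartialHomeomorph f
    have hxe : x ∈ e.source := hstrict'.mem_toOpenPartialHomeomorph_source
    have hinj : Set.InjOn f e.source := e.injOn
    set u := e.source ∩ (f ⁻¹' s ∩ {x | deriv f x ≠ 0})
    have hmeas : MeasurableSet u :=
      e.open_source.measurableSet.inter ((hf.continuous.measurable hs).inter
        (measurable_deriv f (measurableSet_singleton 0).compl))
    refine ⟨u, mem_nhdsWithin.2 ⟨e.source, e.open_source, hxe, fun y hy => hy⟩, ?_⟩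
    have harea := lintegral_image_eq_lintegral_abs_deriv_mul (s := u) (f' := deriv f) hmeas
      (fun y _ => ((hf.differentiable one_ne_zero) y).hasDerivAt.hasDerivWithinAt)
      (hinj.mono Set.inter_subset_left) (fun _ => 1)
    have himage : volume (f '' u) = 0 :=
      measure_mono_null (by rintro _ ⟨y, hy, rfl⟩; exact hy.2.1) hs0
    rw [setLIntegral_one, himage] at harea
    have hae := (lintegral_eq_zero_iff
      (((measurable_deriv f).abs.ennreal_ofReal).mul_const 1)).1 harea.symm
    rw [Filter.EventuallyEq, ae_restrict_iff' hmeas] at hae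
    refine measure_mono_null (fun y hy => ?_) (ae_iff.1 hae)
    simpa [hy] using hy.2.2
  refine measure_mono_null (fun x hx => ?_) (measure_union_null hreg h0)
  by_cases h : deriv f x = 0
  · exact Or.inr h
  · exact Or.inl ⟨hx, h⟩

/-- The Fourier transform of an absolutely continuous finite measure tends to zero at infinity. -/
theorem tendsto_integral_exp_of_absolutelyContinuous (ν : Measure ℝ) [IsFiniteMeasure ν]
    (hν : ν ≪ volume) :
    Tendsto (fun w : ℝ => ∫ x, Complex.exp (2 * Real.pi * Complex.I * (w * x : ℝ)) ∂ν)
      atTop (𝓝 0) := by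
  have h := (Real.tendsto_integral_exp_smul_cocompact
    (fun x => ((ν.rnDeriv volume x).toReal : ℂ))).comp
    (tendsto_neg_atTop_atBot.mono_right atBot_le_cocompact)
  refine h.congr fun w => ?_
  rw [← integral_rnDeriv_smul hν]
  refine integral_congr_ae (Eventually.of_forall fun x => ?_)
  simp only [Circle.smul_def, Real.fourierChar_apply, smul_eq_mul, Complex.real_smul]
  rw [mul_comm]
  congr 2
  push_cast
  ring

/-- Oscillatory integrals with a nonconstant polynomial phase tend to zero. -/
theorem tendsto_integral_exp_polynomial (q : Polynomial ℝ) (hq : Polynomial.derivative q ≠ 0) :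
    Tendsto (fun w : ℝ => ∫ t in (0:ℝ)..1,
      Complex.exp (2 * Real.pi * Complex.I * (w * q.eval t : ℝ))) atTop (𝓝 0) := by
  have hqmp : Measure.QuasiMeasurePreserving (fun t => q.eval t) volume volume := by
    have hsmooth : ContDiff ℝ 1 fun t => q.eval t := by
      simpa only [Polynomial.aeval_def, Polynomial.eval₂_id, Algebra.algebraMap_self] using
        q.contDiff_aeval (𝕜 := ℝ) 1
    refine quasiMeasurePreserving_of_deriv_ne_zero hsmooth ?_
    refine Set.Finite.measure_zero ?_ _
    simpa [Polynomial.IsRoot] using Polynomial.finite_setOfPred_isRoot hq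
  have hac : (volume.restrict (Set.Ioc (0:ℝ) 1)).map (fun t => q.eval t) ≪ volume :=
    (Measure.absolutelyContinuous_of_le Measure.restrict_le_self).map hqmp.measurable
      |>.trans hqmp.absolutelyContinuous
  refine (tendsto_integral_exp_of_absolutelyContinuous _ hac).congr fun w => ?_
  rw [integral_map hqmp.measurable.aemeasurable (by fun_prop),
    intervalIntegral.integral_of_le zero_le_one]

namespace UnitAddTorus

theorem integral_mFourier_eq_zero {ι : Type*} [Fintype ι] {m : ι → ℤ} (hm : m ≠ 0) :
    ∫ z : ι → AddCircle (1:ℝ), mFourier m z = 0 := by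
  classical
  obtain ⟨i, hi⟩ := Function.ne_iff.1 hm
  have hi' : m i ≠ 0 := hi
  refine integral_eq_zero_of_add_right_eq_neg
    (g := Pi.single i (((1:ℝ) / 2 / m i : ℝ) : AddCircle (1:ℝ))) fun z => ?_
  have hshift := fourier_add_half_inv_index hi' (one_pos : (0:ℝ) < 1) (z i)
  simp only [mFourier, ContinuousMap.coe_mk]
  rw [← Finset.mul_prod_erase _ _ (mem_univ i), ← Finset.mul_prod_erase _ _ (mem_univ i),
    ← neg_mul]
  congr 1
  · rw [← hshift, Pi.add_apply, Pi.single_eq_same]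
  · refine Finset.prod_congr rfl fun j hj => ?_
    rw [Pi.add_apply, Pi.single_eq_of_ne (Finset.ne_of_mem_erase hj), add_zero]

theorem mFourier_coe {ι : Type*} [Fintype ι] (m : ι → ℤ) (x : ι → ℝ) :
    mFourier m (fun j => (x j : AddCircle (1:ℝ))) =
      Complex.exp (2 * Real.pi * Complex.I * (∑ j, m j * x j : ℝ)) := by
  simp only [mFourier, ContinuousMap.coe_mk, fourier_coe_apply, ← Complex.exp_sum]
  congr 1
  push_cast
  rw [Finset.mul_sum]
  refine Finset.sum_congr rfl fun j _ => ?_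
  ring

/-- **Weyl's criterion** for continuous families of curves in a torus: convergence of the integrals
of all characters implies convergence of the integrals of all continuous functions. -/
theorem tendsto_integral_of_mFourier {ι α : Type*} [Fintype ι] {l : Filter α}
    {γ : α → ℝ → ι → AddCircle (1:ℝ)} (hγ : ∀ a, Continuous (γ a))
    (h : ∀ m : ι → ℤ, Tendsto (fun a => ∫ t in (0:ℝ)..1, mFourier m (γ a t)) l
      (𝓝 (∫ z : ι → AddCircle (1:ℝ), mFourier m z)))
    (f : C(ι → AddCircle (1:ℝ), ℂ)) :
    Tendsto (fun a => ∫ t in (0:ℝ)..1, f (γ a t)) l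
      (𝓝 (∫ z : ι → AddCircle (1:ℝ), f z)) := by
  have hint (g : C(ι → AddCircle (1:ℝ), ℂ)) (a : α) :
      IntervalIntegrable (fun t => g (γ a t)) volume 0 1 :=
    (g.continuous.comp (hγ a)).intervalIntegrable 0 1
  have hint' (g : C(ι → AddCircle (1:ℝ), ℂ)) :
      Integrable g (volume : Measure (ι → AddCircle (1:ℝ))) :=
    g.continuous.integrable_of_hasCompactSupport (HasCompactSupport.of_compactSpace g)
  have hspan : ∀ g ∈ Submodule.span ℂ (Set.range (mFourier (d := ι))),
      Tendsto (fun a => ∫ t in (0:ℝ)..1, g (γ a t)) l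
        (𝓝 (∫ z : ι → AddCircle (1:ℝ), g z)) := by
    intro g hg
    induction hg using Submodule.span_induction with
    | mem g hg => obtain ⟨m, rfl⟩ := hg; exact h m
    | zero => simpa using tendsto_const_nhds
    | add g₁ g₂ _ _ h₁ h₂ =>
      simp only [ContinuousMap.add_apply]
      rw [integral_add (hint' g₁) (hint' g₂)]
      simp_rw [intervalIntegral.integral_add (hint g₁ _) (hint g₂ _)]
      exact h₁.add h₂
    | smul c g _ hg =>
      simp only [ContinuousMap.smul_apply, integral_smul, intervalIntegral.integral_smul]
      exact hg.const_smul c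
  have hf : f ∈ closure (Submodule.span ℂ (Set.range (mFourier (d := ι))) : Set _) := by
    rw [← Submodule.topologicalClosure_coe, span_mFourier_closure_eq_top]
    trivial
  rw [Metric.tendsto_nhds]
  intro ε hε
  obtain ⟨g, hg, hfg⟩ := Metric.mem_closure_iff.1 hf (ε / 3) (by positivity)
  filter_upwards [Metric.tendsto_nhds.1 (hspan g hg) (ε / 3) (by positivity)] with a ha
  have hpt (z) : ‖f z - g z‖ ≤ ε / 3 := by
    rw [← dist_eq_norm]
    exact (ContinuousMap.dist_apply_le_dist z).trans hfg.le
  have h₁ : dist (∫ t in (0:ℝ)..1, f (γ a t)) (∫ t in (0:ℝ)..1, g (γ a t)) ≤ ε / 3 := by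
    rw [dist_eq_norm, ← intervalIntegral.integral_sub (hint f a) (hint g a)]
    simpa using intervalIntegral.norm_integral_le_of_norm_le_const (a := (0:ℝ)) (b := 1)
      (C := ε / 3) (f := fun t => f (γ a t) - g (γ a t)) fun t _ => hpt _
  have h₂ : dist (∫ z : ι → AddCircle (1:ℝ), g z) (∫ z : ι → AddCircle (1:ℝ), f z) ≤ ε / 3 := by
    rw [dist_comm, dist_eq_norm, ← integral_sub (hint' f) (hint' g)]
    refine (norm_integral_le_of_norm_le_const (Eventually.of_forall hpt)).trans (le_of_eq ?_)
    simp [measureReal_def, volume_pi, Measure.pi_univ, AddCircle.measure_univ]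
  calc _ ≤ _ := dist_triangle4 _ (∫ t in (0:ℝ)..1, g (γ a t)) (∫ z, g z) _
    _ < ε := by linarith

/-- A family of curves equidistributing in a torus becomes dense in it. -/
theorem eventually_dense_of_tendsto_integral {ι α : Type*} [Fintype ι] {l : Filter α}
    {γ : α → ℝ → ι → AddCircle (1:ℝ)}
    (h : ∀ f : C(ι → AddCircle (1:ℝ), ℂ), Tendsto (fun a => ∫ t in (0:ℝ)..1, f (γ a t)) l
      (𝓝 (∫ z : ι → AddCircle (1:ℝ), f z))) {ε : ℝ} (hε : 0 < ε) :
    ∀ᶠ a in l, ∀ z, ∃ t ∈ Set.Icc (0:ℝ) 1, dist (γ a t) z ≤ ε := by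
  obtain ⟨s, -, hs, hcover⟩ := finite_cover_balls_of_compact
    (isCompact_univ (X := ι → AddCircle (1:ℝ))) (half_pos hε)
  have hball : ∀ x ∈ s, ∀ᶠ a in l, ∃ t ∈ Set.Icc (0:ℝ) 1, dist (γ a t) x < ε / 2 := by
    intro x _
    let b : C(ι → AddCircle (1:ℝ), ℝ) := ⟨fun z => max 0 (ε / 2 - dist z x), by fun_prop⟩
    let f : C(ι → AddCircle (1:ℝ), ℂ) := ⟨fun z => (b z : ℂ), by fun_prop⟩
    have hpos : 0 < ∫ z, b z := by
      refine b.continuous.integral_pos_of_hasCompactSupport_nonneg_nonzero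
        (HasCompactSupport.of_compactSpace b) (fun z => le_max_left _ _) (x := x) ?_
      simp [b, hε]
    have hne : ∫ z, f z ≠ 0 := by
      change ∫ z, (b z : ℂ) ≠ 0
      rw [integral_complex_ofReal]
      exact_mod_cast hpos.ne'
    filter_upwards [(h f).eventually_ne hne] with a ha
    by_contra! hfar
    refine ha (intervalIntegral.integral_zero_ae (Eventually.of_forall fun t ht => ?_))
    rw [Set.uIoc_of_le zero_le_one] at ht
    have := hfar t (Set.Ioc_subset_Icc_self ht)
    simp [f, b, this]
  filter_upwards [(hs.eventually_all).2 hball] with a ha z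
  obtain ⟨x, hx, hz⟩ := Set.mem_iUnion₂.1 (hcover (Set.mem_univ z))
  obtain ⟨t, ht, htx⟩ := ha x hx
  refine ⟨t, ht, ?_⟩
  have := dist_triangle_right (γ a t) z x
  rw [Metric.mem_ball] at hz
  linarith

end UnitAddTorus

open UnitAddTorus in
theorem mFourier_dilation {n d : ℕ} (A : Matrix (Fin n) (Fin d) ℝ) (m : Fin n → ℤ) (lam t : ℝ) :
    mFourier m (fun j => ((lam * ∑ k : Fin d, A j k * t ^ ((k : ℕ) + 1) : ℝ) :
      AddCircle (1:ℝ))) =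
    Complex.exp (2 * Real.pi * Complex.I *
      (lam * ∑ k : Fin d, (∑ j, m j * A j k) * t ^ ((k : ℕ) + 1) : ℝ)) := by
  rw [mFourier_coe]
  congr 3
  simp only [Finset.mul_sum, Finset.sum_mul]
  rw [Finset.sum_comm]
  refine Finset.sum_congr rfl fun k _ => Finset.sum_congr rfl fun j _ => ?_
  ring

/-- For a polynomial curve `p_j(t) = ∑_{k=1}^d a_{jk} t^k` in `ℝ^n`, the dilations of `p`
equidistribute in `𝕋^n = ℝ^n/ℤ^n` (i.e. the pushforwards `μ_λ` of Lebesgue measure on `[0,1]`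
under `t ↦ λp(t) mod ℤ^n` converge weak* to the Haar probability measure) if and only if
they become dense (for every `ε > 0` there is `λ > 0` such that the projection of
`λp([0,1])` to `𝕋^n` is `ε`-dense). -/
theorem equidistribution_iff_density (n d : ℕ) (A : Matrix (Fin n) (Fin d) ℝ) :
    (∀ f : C((Fin n → AddCircle (1:ℝ)), ℂ),
        Tendsto (fun lam : ℝ =>
            ∫ t in (0:ℝ)..1,
              f (fun j => ((lam * ∑ k : Fin d, A j k * t ^ ((k : ℕ) + 1) : ℝ) :
                AddCircle (1:ℝ))))
          atTop (nhds (∫ z : Fin n → AddCircle (1:ℝ), f z ∂volume)))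
      ↔
    (∀ ε : ℝ, 0 < ε → ∃ lam : ℝ, 0 < lam ∧
        ∀ z : Fin n → AddCircle (1:ℝ), ∃ t ∈ Set.Icc (0:ℝ) 1,
          dist (fun j => ((lam * ∑ k : Fin d, A j k * t ^ ((k : ℕ) + 1) : ℝ) :
            AddCircle (1:ℝ))) z ≤ ε) := by
  constructor
  · intro h ε hε
    obtain ⟨lam, hlam, hpos⟩ :=
      ((UnitAddTorus.eventually_dense_of_tendsto_integral h hε).and
        (eventually_gt_atTop 0)).exists
    exact ⟨lam, hpos, hlam⟩
  · intro h
    refine UnitAddTorus.tendsto_integral_of_mFourier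
      (γ := fun lam t j => ((lam * ∑ k : Fin d, A j k * t ^ ((k : ℕ) + 1) : ℝ) : AddCircle (1:ℝ)))
      (fun lam => continuous_pi fun j =>
        (AddCircle.continuous_mk' (1:ℝ)).comp (by fun_prop)) fun m => ?_
    rcases eq_or_ne m 0 with rfl | hm
    · simp [UnitAddTorus.mFourier_zero, measureReal_def, volume_pi, Measure.pi_univ,
        AddCircle.measure_univ]
    rw [UnitAddTorus.integral_mFourier_eq_zero hm]
    simp_rw [mFourier_dilation]
    obtain ⟨k₀, hk₀⟩ : ∃ k, ∑ j, m j * A j k ≠ 0 := by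
      by_contra! hzero
      have hone : ∀ z, UnitAddTorus.mFourier m z = 1 := by
        intro z
        have hclosed : IsClosed {z | UnitAddTorus.mFourier m z = 1} :=
          isClosed_eq (UnitAddTorus.mFourier m).continuous continuous_const
        refine hclosed.closure_subset (Metric.mem_closure_iff.2 fun ε hε => ?_)
        obtain ⟨lam, -, hlam⟩ := h (ε / 2) (half_pos hε)
        obtain ⟨t, -, ht⟩ := hlam z
        refine ⟨_, ?_, (dist_comm _ _).trans_lt (ht.trans_lt (half_lt_self hε))⟩
        rw [Set.mem_ofPred_eq, mFourier_dilation]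
        simp [hzero]
      have hint := UnitAddTorus.integral_mFourier_eq_zero hm
      simp [hone, measureReal_def, volume_pi, Measure.pi_univ, AddCircle.measure_univ] at hint
    let q : Polynomial ℝ := ∑ k : Fin d,
      Polynomial.C (∑ j, m j * A j k) * Polynomial.X ^ ((k : ℕ) + 1)
    have hcoeff : q.coeff ((k₀ : ℕ) + 1) = ∑ j, m j * A j k₀ := by
      simp only [q, Polynomial.finsetSum_coeff, Polynomial.coeff_C_mul_X_pow]
      rw [Finset.sum_eq_single k₀] <;> simp +contextual [Fin.ext_iff, eq_comm]
    have hq : Polynomial.derivative q ≠ 0 := by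
      intro hder
      have := Polynomial.derivative_eq_zero.1 hder
      exact hk₀ (hcoeff ▸ Polynomial.coeff_eq_zero_of_natDegree_lt (by omega))
    simpa [q, Polynomial.eval_finsetSum] using tendsto_integral_exp_polynomial q hq
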